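/- Let α ∈ (0,∞) and z ∈ (0,∞). The following are equivalent: (1) D_{α,z}(ρ‖σ) ≤ D_max(ρ‖σ) for all nonzero PSD operators ρ, σ on every finite-dimensional complex Hilbert space; (2) D_{α,z}(ρ‖σ) ≤ D_max(ρ‖σ) for all density operators ρ, σ on some finite-dimensional complex Hilbert space ℋ with dim ℋ ≥ 2; (3) α ∈ (0,1], or (α ∈ (1,∞) and z ≥ α−1). -/

import Mathlib

open Filter Set Topology
open scoped ComplexOrder

noncomputable section

namespace QRenyi

attribute [local instance] Classical.propDecidable

variable {ι : Type*} [Fintype ι] [DecidableEq ι]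

/-- Apply a real function to the eigenvalues of a Hermitian matrix (functional calculus);
junk value `0` for non-Hermitian matrices. -/
noncomputable def hermApply (f : ℝ → ℝ) (A : Matrix ι ι ℂ) : Matrix ι ι ℂ :=
  if hA : A.IsHermitian then hA.cfc f else 0

/-- Real power of a positive semidefinite matrix, taken on its support:
`t ↦ t ^ x` is applied to the nonzero eigenvalues and `0` is mapped to `0`.
In particular `matPow A 0` is the support projection of `A`. -/
noncomputable def matPow (A : Matrix ι ι ℂ) (x : ℝ) : Matrix ι ι ℂ :=
  hermApply (fun t => if t = 0 then 0 else t ^ x) A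

/-- Logarithm of a positive semidefinite matrix taken on its support
(`Real.log 0 = 0` in Mathlib, matching the convention `log̃ 0 = 0`). -/
noncomputable def matLog (A : Matrix ι ι ℂ) : Matrix ι ι ℂ :=
  hermApply Real.log A

/-- `supp ρ ≤ supp σ`, expressed (for PSD matrices) as inclusion of kernels. -/
def suppLE (ρ σ : Matrix ι ι ℂ) : Prop :=
  ∀ v : ι → ℂ, σ.mulVec v = 0 → ρ.mulVec v = 0

/-- The Loewner (positive semidefinite) order. -/
def loewnerLE (A B : Matrix ι ι ℂ) : Prop := (B - A).PosSemidef

/-- Real part of the trace. -/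
noncomputable def reTrace (A : Matrix ι ι ℂ) : ℝ := A.trace.re

/-- The trace quantity `Tr ((σ^{(1-α)/(2z)} ρ^{α/z} σ^{(1-α)/(2z)})^z)` (a real number). -/
noncomputable def Qaz (α z : ℝ) (ρ σ : Matrix ι ι ℂ) : ℝ :=
  reTrace (matPow (matPow σ ((1 - α) / (2 * z)) * matPow ρ (α / z) *
    matPow σ ((1 - α) / (2 * z))) z)

/-- The Rényi `(α,z)`-divergence (for `α ≠ 1`), with values in `EReal = ℝ ∪ {±∞}`.
It equals `(α-1)⁻¹ (log Q_{α,z}(ρ‖σ) - log Tr ρ)`; it is `+∞` when `α > 1` and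
`supp ρ ≰ supp σ`, and also `+∞` when `α < 1` and `Q_{α,z}(ρ‖σ) = 0`
(i.e. `(α-1)⁻¹ log 0 = +∞`). -/
noncomputable def Daz (α z : ℝ) (ρ σ : Matrix ι ι ℂ) : EReal :=
  if (suppLE ρ σ ∨ α < 1) ∧ Qaz α z ρ σ ≠ 0 then
    (((α - 1)⁻¹ * (Real.log (Qaz α z ρ σ) - Real.log (reTrace ρ)) : ℝ) : EReal)
  else ⊤

/-- The (normalized) Umegaki relative entropy. -/
noncomputable def DUm (ρ σ : Matrix ι ι ℂ) : EReal :=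
  if suppLE ρ σ then
    (((reTrace ρ)⁻¹ * reTrace (ρ * (matLog ρ - matLog σ)) : ℝ) : EReal)
  else ⊤

/-- The Rényi `(α,z)`-divergence, with `D_{1,z} := D^Um`. -/
noncomputable def Dfull (α z : ℝ) (ρ σ : Matrix ι ι ℂ) : EReal :=
  if α = 1 then DUm ρ σ else Daz α z ρ σ

/-- The max-relative entropy `D_max(ρ‖σ) = log inf {λ > 0 : ρ ≤ λ σ}`. -/
noncomputable def Dmax (ρ σ : Matrix ι ι ℂ) : EReal :=
  if ∃ c : ℝ, 0 < c ∧ loewnerLE ρ (c • σ) then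
    ((Real.log (sInf {c : ℝ | 0 < c ∧ loewnerLE ρ (c • σ)}) : ℝ) : EReal)
  else ⊤

/-- The classical quantity `Q_α^cl(ρ‖σ) = ∑_x ρ(x)^α σ(x)^{1-α}` (with `0^t = 0` for `t ≠ 0`). -/
noncomputable def Qcl {X : Type*} [Fintype X] (α : ℝ) (ρ σ : X → ℝ) : ℝ :=
  ∑ x, ρ x ^ α * σ x ^ (1 - α)

/-- Absolute continuity `ρ ≪ σ` for functions on a finite set. -/
def acl {X : Type*} (ρ σ : X → ℝ) : Prop := ∀ x, σ x = 0 → ρ x = 0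

/-- The classical Rényi `α`-divergence, with values in `EReal`; for `α = 1` it is the
(normalized) Kullback-Leibler divergence. -/
noncomputable def Dcl {X : Type*} [Fintype X] (α : ℝ) (ρ σ : X → ℝ) : EReal :=
  if α = 1 then
    (if acl ρ σ then
      ((((∑ x, ρ x)⁻¹ * ∑ x, ρ x * (Real.log (ρ x) - Real.log (σ x))) : ℝ) : EReal)
     else ⊤)
  else if (acl ρ σ ∨ α < 1) ∧ Qcl α ρ σ ≠ 0 then
    ((((α - 1)⁻¹ * (Real.log (Qcl α ρ σ) - Real.log (∑ x, ρ x))) : ℝ) : EReal)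
  else ⊤

/-- The measured Rényi `α`-divergence: supremum over all finite-outcome POVMs. -/
noncomputable def Dmeas (α : ℝ) (ρ σ : Matrix ι ι ℂ) : EReal :=
  ⨆ (k : ℕ) (M : Fin k → Matrix ι ι ℂ)
    (_ : (∀ i, (M i).PosSemidef) ∧ ∑ i, M i = 1),
    Dcl α (fun i => reTrace (M i * ρ)) (fun i => reTrace (M i * σ))

/-- A `κ`-function: a continuous nonnegative function on `[0,∞)` with
`limsup_{x→0⁺} f(x) x^{-κ} < ∞`. -/
def IsKappaFunction (κ : ℝ) (f : ℝ → ℝ) : Prop :=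
  ContinuousOn f (Set.Ici 0) ∧ (∀ x ∈ Set.Ici (0 : ℝ), 0 ≤ f x) ∧
    ∃ M : ℝ, ∀ᶠ x in 𝓝[>] (0 : ℝ), f x ≤ M * x ^ κ

/-- A strict `κ`-function: a `κ`-function with `liminf_{x→0⁺} f(x) x^{-κ} > 0`. -/
def IsStrictKappaFunction (κ : ℝ) (f : ℝ → ℝ) : Prop :=
  IsKappaFunction κ f ∧ ∃ c : ℝ, 0 < c ∧ ∀ᶠ x in 𝓝[>] (0 : ℝ), c * x ^ κ ≤ f x

/-- Nonzero PSD matrix predicate. -/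
def PSDne (A : Matrix ι ι ℂ) : Prop := A.PosSemidef ∧ A ≠ 0

/-- The real quadratic form of a matrix. -/
def quadForm (M : Matrix ι ι ℂ) (v : ι → ℂ) : ℝ := (star v ⬝ᵥ M.mulVec v).re

/-- Coordinates of a vector in the eigenbasis of a Hermitian matrix. -/
def eigCoord {A : Matrix ι ι ℂ} (hA : A.IsHermitian) (v : ι → ℂ) : ι → ℂ :=
  (star (hA.eigenvectorUnitary : Matrix ι ι ℂ)).mulVec v

/-- The eigenbasis vectors, as plain functions. -/
def eigVec {A : Matrix ι ι ℂ} (hA : A.IsHermitian) (i : ι) : ι → ℂ :=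
  (hA.eigenvectorUnitary : Matrix ι ι ℂ).mulVec (Pi.single i 1)

theorem hermApply_eq_cfc (f : ℝ → ℝ) (A : Matrix ι ι ℂ) : hermApply f A = cfc f A := by
  unfold hermApply
  split_ifs with hA
  · exact (hA.cfc_eq f).symm
  · exact (cfc_apply_of_not_predicate A hA).symm

theorem continuousOn_spectrum (f : ℝ → ℝ) (A : Matrix ι ι ℂ) :
    ContinuousOn f (spectrum ℝ A) :=
  (Matrix.finite_real_spectrum).continuousOn f

theorem isHermitian_hermApply (f : ℝ → ℝ) (A : Matrix ι ι ℂ) : (hermApply f A).IsHermitian := by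
  rw [hermApply_eq_cfc]
  exact cfc_predicate f A

theorem hermApply_mul (f g : ℝ → ℝ) (A : Matrix ι ι ℂ) :
    hermApply f A * hermApply g A = hermApply (fun t => f t * g t) A := by
  simp only [hermApply_eq_cfc]
  exact (cfc_mul f g A (continuousOn_spectrum f A) (continuousOn_spectrum g A)).symm

theorem hermApply_comp (f g : ℝ → ℝ) {A : Matrix ι ι ℂ} (hA : A.IsHermitian) :
    hermApply g (hermApply f A) = hermApply (fun t => g (f t)) A := by
  simp only [hermApply_eq_cfc]
  exact (cfc_comp' g f A (((Matrix.finite_real_spectrum).image f).continuousOn g)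
    (continuousOn_spectrum f A) hA).symm

theorem hermApply_id {A : Matrix ι ι ℂ} (hA : A.IsHermitian) : hermApply (fun t => t) A = A := by
  rw [hermApply_eq_cfc]
  exact cfc_id' ℝ A hA

theorem hermApply_congr {f g : ℝ → ℝ} {A : Matrix ι ι ℂ} (hA : A.PosSemidef)
    (h : ∀ t, 0 ≤ t → f t = g t) : hermApply f A = hermApply g A := by
  unfold hermApply
  rw [dif_pos hA.1, dif_pos hA.1]
  unfold Matrix.IsHermitian.cfc
  congr 3
  ext i
  simp [h _ (hA.eigenvalues_nonneg i)]

theorem quadForm_hermApply (f : ℝ → ℝ) {A : Matrix ι ι ℂ} (hA : A.IsHermitian) (v : ι → ℂ) :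
    quadForm (hermApply f A) v = ∑ i, f (hA.eigenvalues i) * ‖eigCoord hA v i‖ ^ 2 := by
  unfold quadForm hermApply eigCoord
  rw [dif_pos hA]
  unfold Matrix.IsHermitian.cfc
  rw [Unitary.conjStarAlgAut_apply, ← Matrix.mulVec_mulVec, ← Matrix.mulVec_mulVec,
    Matrix.dotProduct_mulVec]
  have h : Matrix.vecMul (star v) (hA.eigenvectorUnitary : Matrix ι ι ℂ) =
      star ((star (hA.eigenvectorUnitary : Matrix ι ι ℂ)).mulVec v) := by
    rw [Matrix.star_mulVec, Matrix.star_eq_conjTranspose, Matrix.conjTranspose_conjTranspose]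
  rw [h]
  simp only [dotProduct, Matrix.mulVec_diagonal, Complex.re_sum]
  refine Finset.sum_congr rfl fun i _ => ?_
  generalize (star (hA.eigenvectorUnitary : Matrix ι ι ℂ)).mulVec v = w
  rw [← Complex.normSq_eq_norm_sq, Complex.normSq_apply]
  simp
  ring

theorem reTrace_hermApply (f : ℝ → ℝ) {A : Matrix ι ι ℂ} (hA : A.IsHermitian) :
    reTrace (hermApply f A) = ∑ i, f (hA.eigenvalues i) := by
  unfold reTrace hermApply
  rw [dif_pos hA]
  unfold Matrix.IsHermitian.cfc
  rw [Unitary.conjStarAlgAut_apply, Matrix.trace_mul_cycle]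
  simp [Matrix.trace]

theorem reTrace_mul_hermApply (f : ℝ → ℝ) {A : Matrix ι ι ℂ} (hA : A.IsHermitian)
    (M : Matrix ι ι ℂ) :
    reTrace (hermApply f A * M) = ∑ i, f (hA.eigenvalues i) * quadForm M (eigVec hA i) := by
  unfold reTrace hermApply quadForm eigVec
  rw [dif_pos hA]
  unfold Matrix.IsHermitian.cfc
  rw [Unitary.conjStarAlgAut_apply, Matrix.mul_assoc, Matrix.mul_assoc, Matrix.trace_mul_comm,
    Matrix.mul_assoc]
  simp only [Matrix.trace, Complex.re_sum]
  refine Finset.sum_congr rfl fun i _ => ?_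
  rw [Matrix.star_mulVec, ← Matrix.dotProduct_mulVec, Matrix.mulVec_mulVec, Matrix.mulVec_mulVec]
  simp [Matrix.mul_assoc, Matrix.star_eq_conjTranspose]

theorem eigCoord_eigVec {A : Matrix ι ι ℂ} (hA : A.IsHermitian) (i : ι) :
    eigCoord hA (eigVec hA i) = Pi.single i 1 := by
  unfold eigCoord eigVec
  rw [Matrix.mulVec_mulVec, Unitary.coe_star_mul_self, Matrix.one_mulVec]

theorem mulVec_eigVec {A : Matrix ι ι ℂ} (hA : A.IsHermitian) (i : ι) :
    A.mulVec (eigVec hA i) = (hA.eigenvalues i : ℂ) • eigVec hA i := by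
  unfold eigVec
  rw [hA.eigenvectorUnitary_mulVec, hA.mulVec_eigenvectorBasis]
  rfl

theorem hermApply_mulVec (f : ℝ → ℝ) {A : Matrix ι ι ℂ} (hA : A.IsHermitian) {t : ℝ} {v : ι → ℂ}
    (h : A.mulVec v = (t : ℂ) • v) : (hermApply f A).mulVec v = (f t : ℂ) • v := by
  set U : Matrix ι ι ℂ := (hA.eigenvectorUnitary : Matrix ι ι ℂ) with hU
  have hUU : star U * U = 1 := by simp [hU]
  have hUU' : U * star U = 1 := by simp [hU]
  have hv : v = U.mulVec ((star U).mulVec v) := by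
    rw [Matrix.mulVec_mulVec, hUU', Matrix.one_mulVec]
  have hform : ∀ g : ℝ → ℝ, (star U).mulVec ((hermApply g A).mulVec v) =
      fun i => (g (hA.eigenvalues i) : ℂ) * (star U).mulVec v i := by
    intro g
    unfold hermApply
    rw [dif_pos hA]
    unfold Matrix.IsHermitian.cfc
    rw [Unitary.conjStarAlgAut_apply, Matrix.mulVec_mulVec, ← Matrix.mul_assoc, ← Matrix.mul_assoc,
      hUU, Matrix.one_mul, ← Matrix.mulVec_mulVec]
    ext i
    rw [Matrix.mulVec_diagonal]
    rfl
  have hid := hform fun t => t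
  rw [hermApply_id hA, h, Matrix.mulVec_smul] at hid
  have hf := hform f
  have : (hermApply f A).mulVec v = U.mulVec ((star U).mulVec ((hermApply f A).mulVec v)) := by
    rw [Matrix.mulVec_mulVec _ U, hUU', Matrix.one_mulVec]
  rw [this, hf]
  conv_rhs => rw [hv, ← Matrix.mulVec_smul]
  congr 1
  ext i
  have hi := congrFun hid i
  simp only [Pi.smul_apply, smul_eq_mul] at hi ⊢
  by_cases h0 : (star U).mulVec v i = 0
  · simp [h0]
  · have := mul_right_cancel₀ h0 hi
    rw [Complex.ofReal_inj.1 this]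

theorem quadForm_self {A : Matrix ι ι ℂ} (hA : A.IsHermitian) (v : ι → ℂ) :
    quadForm A v = ∑ i, hA.eigenvalues i * ‖eigCoord hA v i‖ ^ 2 := by
  conv_lhs => rw [← hermApply_id hA]
  exact quadForm_hermApply _ hA v

theorem quadForm_one {A : Matrix ι ι ℂ} (hA : A.IsHermitian) (v : ι → ℂ) :
    quadForm 1 v = ∑ i, ‖eigCoord hA v i‖ ^ 2 := by
  have h := quadForm_hermApply (fun _ => 1) hA v
  have h1 : cfc (fun _ : ℝ => (1 : ℝ)) A = 1 := cfc_const_one ℝ A hA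
  rw [hermApply_eq_cfc, h1] at h
  simpa using h

omit [DecidableEq ι] in
theorem quadForm_sub (A B : Matrix ι ι ℂ) (v : ι → ℂ) :
    quadForm (A - B) v = quadForm A v - quadForm B v := by
  simp [quadForm, Matrix.sub_mulVec, dotProduct_sub]

omit [DecidableEq ι] in
theorem quadForm_smul (c : ℝ) (A : Matrix ι ι ℂ) (v : ι → ℂ) :
    quadForm (c • A) v = c * quadForm A v := by
  simp [quadForm, Matrix.smul_mulVec]

theorem quadForm_one_eq (v : ι → ℂ) : quadForm 1 v = ∑ i, ‖v i‖ ^ 2 := by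
  simp only [quadForm, Matrix.one_mulVec, dotProduct, Complex.re_sum]
  refine Finset.sum_congr rfl fun i _ => ?_
  rw [← Complex.normSq_eq_norm_sq, Complex.normSq_apply]
  simp

theorem quadForm_one_pos {v : ι → ℂ} (hv : v ≠ 0) : 0 < quadForm 1 v := by
  rw [quadForm_one_eq]
  obtain ⟨i, hi⟩ := Function.ne_iff.1 hv
  exact Finset.sum_pos' (fun _ _ => by positivity) ⟨i, Finset.mem_univ i, by
    have : 0 < ‖v i‖ := norm_pos_iff.2 hi
    positivity⟩

omit [DecidableEq ι] in
theorem quadForm_conj (A H : Matrix ι ι ℂ) (hH : H.IsHermitian) (v : ι → ℂ) :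
    quadForm (H * A * H) v = quadForm A (H.mulVec v) := by
  unfold quadForm
  rw [Matrix.star_mulVec, hH.eq, ← Matrix.dotProduct_mulVec, Matrix.mulVec_mulVec,
    Matrix.mulVec_mulVec, Matrix.mul_assoc]

omit [DecidableEq ι] in
theorem quadForm_nonneg {A : Matrix ι ι ℂ} (hA : A.PosSemidef) (v : ι → ℂ) : 0 ≤ quadForm A v :=
  hA.re_dotProduct_nonneg v

/-- A one-sided Courant–Fischer comparison of ordered eigenvalues. -/
theorem eigenvalues_compare {A B : Matrix ι ι ℂ} (hA : A.IsHermitian) (hB : B.IsHermitian)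
    (g : ℝ → ℝ)
    (h : ∀ (j : ι) (v : ι → ℂ),
      (∀ i, hA.eigenvalues i < hA.eigenvalues j → eigCoord hA v i = 0) →
      g (hA.eigenvalues j) * quadForm 1 v ≤ quadForm B v) (k : ι) :
    g (hA.eigenvalues k) ≤ hB.eigenvalues k := by
  let e : ι ≃ Fin (Fintype.card ι) := (Fintype.equivOfCardEq (Fintype.card_fin _)).symm
  have eA : ∀ i, hA.eigenvalues i = hA.eigenvalues₀ (e i) := fun _ => rfl
  have eB : ∀ i, hB.eigenvalues i = hB.eigenvalues₀ (e i) := fun _ => rfl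
  let M : Matrix ι ι ℂ := fun i =>
    if e k < e i then (star (hA.eigenvectorUnitary : Matrix ι ι ℂ)) i
    else if e i < e k then (star (hB.eigenvectorUnitary : Matrix ι ι ℂ)) i else 0
  have hdet : M.det = 0 := Matrix.det_eq_zero_of_row_eq_zero k fun j => by simp [M]
  obtain ⟨v, hv0, hv⟩ := Matrix.exists_mulVec_eq_zero_iff.2 hdet
  have hvA : ∀ i, e k < e i → eigCoord hA v i = 0 := by
    intro i hi
    have := congrFun hv i
    simp only [Matrix.mulVec, M, if_pos hi, Pi.zero_apply] at this
    exact this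
  have hvB : ∀ i, e i < e k → eigCoord hB v i = 0 := by
    intro i hi
    have := congrFun hv i
    simp only [Matrix.mulVec, M, if_neg hi.not_gt, if_pos hi, Pi.zero_apply] at this
    exact this
  have h1 := h k v fun i hi => hvA i <| by
    by_contra hlt
    exact absurd (hA.eigenvalues₀_antitone (not_lt.1 hlt)) (not_le.2 hi)
  have h2 : quadForm B v ≤ hB.eigenvalues k * quadForm 1 v := by
    rw [quadForm_self hB, quadForm_one hB, Finset.mul_sum]
    refine Finset.sum_le_sum fun i _ => ?_
    by_cases hi : e i < e k
    · simp [hvB i hi]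
    · exact mul_le_mul_of_nonneg_right (hB.eigenvalues₀_antitone (not_lt.1 hi)) (by positivity)
  exact le_of_mul_le_mul_right (h1.trans h2) (quadForm_one_pos hv0)

open scoped Matrix.Norms.L2Operator MatrixOrder in
theorem hermApply_rpow_mono {s : ℝ} (hs0 : 0 < s) (hs1 : s ≤ 1) {A B : Matrix ι ι ℂ}
    (hA : A.PosSemidef) (hB : B.PosSemidef) (h : (B - A).PosSemidef) :
    (matPow B s - matPow A s).PosSemidef := by
  have h1 : A ≤ B := h
  have h2 := CFC.rpow_le_rpow (p := s) ⟨hs0.le, hs1⟩ h1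
  have key : ∀ C : Matrix ι ι ℂ, C.PosSemidef → matPow C s = C ^ s := by
    intro C hC
    rw [CFC.rpow_eq_cfc_real (a := C) (y := s) (Matrix.nonneg_iff_posSemidef.2 hC),
      ← hermApply_eq_cfc]
    refine hermApply_congr hC fun t ht => ?_
    split_ifs with h0
    · rw [h0, Real.zero_rpow hs0.ne']
    · rfl
  rw [key A hA, key B hB]
  exact h2
theorem isHermitian_matPow (A : Matrix ι ι ℂ) (x : ℝ) : (matPow A x).IsHermitian :=
  isHermitian_hermApply _ A

theorem matPow_mul {A : Matrix ι ι ℂ} (hA : A.PosSemidef) (x y : ℝ) :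
    matPow A x * matPow A y = matPow A (x + y) := by
  unfold matPow
  rw [hermApply_mul]
  refine hermApply_congr hA fun t ht => ?_
  split_ifs with h0
  · simp
  · rw [Real.rpow_add (lt_of_le_of_ne ht (Ne.symm h0))]

theorem matPow_one {A : Matrix ι ι ℂ} (hA : A.PosSemidef) : matPow A 1 = A := by
  conv_rhs => rw [← hermApply_id hA.1]
  refine hermApply_congr hA fun t _ => ?_
  split_ifs with h0 <;> simp [h0]

theorem matPow_matPow {A : Matrix ι ι ℂ} (hA : A.PosSemidef) (x y : ℝ) :
    matPow (matPow A x) y = matPow A (x * y) := by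
  unfold matPow
  rw [hermApply_comp _ _ hA.1]
  refine hermApply_congr hA fun t ht => ?_
  by_cases h0 : t = 0
  · simp [h0]
  · have : t ^ x ≠ 0 := (Real.rpow_pos_of_pos (lt_of_le_of_ne ht (Ne.symm h0)) x).ne'
    simp [h0, this, Real.rpow_mul ht]

theorem posSemidef_matPow {A : Matrix ι ι ℂ} (hA : A.PosSemidef) (x : ℝ) :
    (matPow A x).PosSemidef := by
  have h := Matrix.posSemidef_conjTranspose_mul_self (matPow A (x / 2))
  rwa [(isHermitian_matPow A (x / 2)).eq, matPow_mul hA, add_halves] at h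

theorem hermApply_const_mul (c : ℝ) (f : ℝ → ℝ) (A : Matrix ι ι ℂ) :
    hermApply (fun t => c * f t) A = c • hermApply f A := by
  simp only [hermApply_eq_cfc]
  exact cfc_const_mul c f A (continuousOn_spectrum f A)

theorem matPow_smul {A : Matrix ι ι ℂ} (hA : A.PosSemidef) {c : ℝ} (hc : 0 < c) (x : ℝ) :
    matPow (c • A) x = c ^ x • matPow A x := by
  have h : c • A = hermApply (fun t => c * t) A := by
    rw [hermApply_const_mul, hermApply_id hA.1]
  unfold matPow
  rw [h, hermApply_comp _ _ hA.1, ← hermApply_const_mul]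
  refine hermApply_congr hA fun t ht => ?_
  by_cases h0 : t = 0
  · simp [h0]
  · simp [h0, hc.ne', Real.mul_rpow hc.le ht]

theorem reTrace_matPow {A : Matrix ι ι ℂ} (hA : A.PosSemidef) {z : ℝ} (hz : 0 < z) :
    reTrace (matPow A z) = ∑ i, hA.1.eigenvalues i ^ z := by
  unfold matPow
  rw [reTrace_hermApply _ hA.1]
  refine Finset.sum_congr rfl fun i _ => ?_
  split_ifs with h
  · rw [h, Real.zero_rpow hz.ne']
  · rfl

theorem reTrace_eq_sum {A : Matrix ι ι ℂ} (hA : A.IsHermitian) :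
    reTrace A = ∑ i, hA.eigenvalues i := by
  conv_lhs => rw [← hermApply_id hA]
  exact reTrace_hermApply _ hA

theorem reTrace_pos {A : Matrix ι ι ℂ} (hA : A.PosSemidef) (h0 : A ≠ 0) : 0 < reTrace A := by
  rw [reTrace_eq_sum hA.1]
  refine lt_of_le_of_ne (Finset.sum_nonneg fun i _ => hA.eigenvalues_nonneg i) fun h => h0 ?_
  rw [eq_comm, Finset.sum_eq_zero_iff_of_nonneg fun i _ => hA.eigenvalues_nonneg i] at h
  exact hA.1.eigenvalues_eq_zero_iff.1 (funext fun i => h i (Finset.mem_univ i))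

theorem reTrace_matPow_mul_comm (X : Matrix ι ι ℂ) {z : ℝ} (hz : 0 < z) :
    reTrace (matPow (X.conjTranspose * X) z) = reTrace (matPow (X * X.conjTranspose) z) := by
  have h1 := Matrix.posSemidef_conjTranspose_mul_self X
  have h2 := Matrix.posSemidef_self_mul_conjTranspose X
  rw [reTrace_matPow h1 hz, reTrace_matPow h2 hz,
    (Matrix.IsHermitian.eigenvalues_eq_eigenvalues_iff h1.1 h2.1).2
      (Matrix.charpoly_mul_comm _ _)]

theorem Qaz_eq {ρ σ : Matrix ι ι ℂ} (hρ : ρ.PosSemidef) (hσ : σ.PosSemidef) (α : ℝ) {z : ℝ}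
    (hz : 0 < z) :
    Qaz α z ρ σ = reTrace (matPow (matPow ρ (α / z / 2) * matPow σ ((1 - α) / z) *
      matPow ρ (α / z / 2)) z) := by
  have h := reTrace_matPow_mul_comm (matPow ρ (α / z / 2) * matPow σ ((1 - α) / (2 * z))) hz
  rw [Matrix.conjTranspose_mul, (isHermitian_matPow ρ _).eq, (isHermitian_matPow σ _).eq] at h
  unfold Qaz
  convert h using 3
  · rw [← add_halves (α / z), ← matPow_mul hρ]
    simp [Matrix.mul_assoc]
  · rw [show (1 - α) / z = (1 - α) / (2 * z) + (1 - α) / (2 * z) by field_simp; ring,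
      ← matPow_mul hσ]
    simp [Matrix.mul_assoc]

omit [DecidableEq ι] in
theorem posSemidef_conj {A H : Matrix ι ι ℂ} (hA : A.PosSemidef) (hH : H.IsHermitian) :
    (H * A * H).PosSemidef := by
  have := hA.mul_mul_conjTranspose_same H
  rwa [hH.eq] at this

omit [DecidableEq ι] in
theorem suppLE_of_loewnerLE {ρ σ : Matrix ι ι ℂ} (hρ : ρ.PosSemidef) {c : ℝ}
    (h : loewnerLE ρ (c • σ)) : suppLE ρ σ := by
  intro v hv
  have h1 := quadForm_nonneg h v
  rw [quadForm_sub, quadForm_smul] at h1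
  have h2 : quadForm σ v = 0 := by simp [quadForm, hv]
  rw [h2] at h1
  have h3 : quadForm ρ v = 0 := le_antisymm (by linarith) (quadForm_nonneg hρ v)
  refine (hρ.dotProduct_mulVec_zero_iff v).1 (Complex.ext h3 ?_)
  exact ((Complex.nonneg_iff.1 (hρ.dotProduct_mulVec_nonneg v)).2).symm

theorem quadForm_matPow_le {ρ σ : Matrix ι ι ℂ} (hρ : ρ.PosSemidef) (hσ : σ.PosSemidef) {c : ℝ}
    (hc : 0 < c) (h : loewnerLE ρ (c • σ)) {s : ℝ} (hs0 : 0 < s) (hs1 : s ≤ 1) (v : ι → ℂ) :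
    quadForm (matPow ρ s) v ≤ c ^ s * quadForm (matPow σ s) v := by
  have h1 := quadForm_nonneg (hermApply_rpow_mono hs0 hs1 hρ (hσ.smul hc.le) h) v
  rw [quadForm_sub, matPow_smul hσ hc, quadForm_smul] at h1
  linarith

theorem quadForm_conj_neg_le {ρ σ : Matrix ι ι ℂ} (hρ : ρ.PosSemidef) (hσ : σ.PosSemidef) {c : ℝ}
    (hc : 0 < c) (h : loewnerLE ρ (c • σ)) {s : ℝ} (hs0 : 0 < s) (hs1 : s ≤ 1) (u : ι → ℂ) :
    quadForm (matPow ρ (s / 2) * matPow σ (-s) * matPow ρ (s / 2)) u ≤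
      c ^ s * quadForm 1 u := by
  set R := matPow ρ (s / 2) with hR
  set S := matPow σ (-s) with hS
  have hRh : R.IsHermitian := isHermitian_matPow _ _
  have hSh : S.IsHermitian := isHermitian_matPow _ _
  set Z := R * S * R with hZ
  have hZh : Z.IsHermitian := (posSemidef_conj (posSemidef_matPow hσ _) hRh).1
  have hK : 0 < c ^ s := Real.rpow_pos_of_pos hc s
  set K := c ^ s
  have hZZ : quadForm (Z * Z) u ≤ K * quadForm Z u := by
    have e1 : Z * Z = R * (S * matPow ρ s * S) * R := by
      rw [← add_halves s, ← matPow_mul hρ]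
      simp [hZ, hR, Matrix.mul_assoc]
    have e2 : Z = R * (S * matPow σ s * S) * R := by
      have : S * matPow σ s * S = S := by
        rw [hS, matPow_mul hσ, matPow_mul hσ]
        congr 1
        ring
      rw [this]
    rw [e1, quadForm_conj _ _ hRh, quadForm_conj _ _ hSh]
    conv_rhs => rw [e2, quadForm_conj _ _ hRh, quadForm_conj _ _ hSh]
    exact quadForm_matPow_le hρ hσ hc h hs0 hs1 _
  have hT : (K • (1 : Matrix ι ι ℂ) - Z).IsHermitian :=
    ((Matrix.PosSemidef.one (n := ι) (R := ℂ)).smul hK.le).1.sub hZh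
  have h0 := quadForm_nonneg (posSemidef_conj Matrix.PosSemidef.one hT) u
  have e : (K • (1 : Matrix ι ι ℂ) - Z) * 1 * (K • (1 : Matrix ι ι ℂ) - Z) =
      K • (K • (1 : Matrix ι ι ℂ) - Z) - (K • Z - Z * Z) := by
    simp only [mul_one, mul_sub, sub_mul, Matrix.smul_mul, Matrix.mul_smul, smul_sub, one_mul]
  rw [e] at h0
  simp only [quadForm_sub, quadForm_smul] at h0
  have h2 : 0 ≤ K * (K * quadForm 1 u - quadForm Z u) := by linarith
  have := nonneg_of_mul_nonneg_right h2 hK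
  linarith

theorem quadForm_matPow_pos {σ : Matrix ι ι ℂ} (hσ : σ.PosSemidef) {v : ι → ℂ}
    (hv : 0 < quadForm σ v) (x : ℝ) : 0 < quadForm (matPow σ x) v := by
  rw [quadForm_self hσ.1] at hv
  obtain ⟨i, _, hi⟩ := Finset.exists_lt_of_sum_lt (s := Finset.univ) (f := fun _ : ι => (0 : ℝ))
    (by simpa using hv)
  unfold matPow
  rw [quadForm_hermApply _ hσ.1]
  have hterm : ∀ j, 0 ≤ (if hσ.1.eigenvalues j = 0 then 0 else hσ.1.eigenvalues j ^ x) := by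
    intro j
    split_ifs
    · exact le_rfl
    · exact Real.rpow_nonneg (hσ.eigenvalues_nonneg j) x
  refine Finset.sum_pos' (fun j _ => mul_nonneg (hterm j) (by positivity))
    ⟨i, Finset.mem_univ i, ?_⟩
  have hl : 0 < hσ.1.eigenvalues i := by
    refine lt_of_le_of_ne (hσ.eigenvalues_nonneg i) fun h => ?_
    rw [← h] at hi
    simp at hi
  have hn : 0 < ‖eigCoord hσ.1 v i‖ ^ 2 := by
    refine lt_of_le_of_ne (by positivity) fun h => ?_
    rw [← h] at hi
    simp at hi
  rw [if_neg hl.ne']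
  exact mul_pos (Real.rpow_pos_of_pos hl x) hn

theorem quadForm_eigVec {A : Matrix ι ι ℂ} (hA : A.IsHermitian) (f : ℝ → ℝ) (i : ι) :
    quadForm (hermApply f A) (eigVec hA i) = f (hA.eigenvalues i) := by
  rw [quadForm_hermApply f hA, eigCoord_eigVec, Finset.sum_eq_single i]
  · simp
  · intro j _ hj
    simp [hj]
  · simp

omit [DecidableEq ι] in
theorem quadForm_smul_vec (A : Matrix ι ι ℂ) (r : ℝ) (v : ι → ℂ) :
    quadForm A ((r : ℂ) • v) = r ^ 2 * quadForm A v := by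
  simp [quadForm, Matrix.mulVec_smul]
  ring

theorem Qaz_pos {ρ σ : Matrix ι ι ℂ} (hρ : ρ.PosSemidef) (h0 : ρ ≠ 0) (hσ : σ.PosSemidef) {c : ℝ}
    (hc : 0 < c) (h : loewnerLE ρ (c • σ)) (α : ℝ) {z : ℝ} (hz : 0 < z) : 0 < Qaz α z ρ σ := by
  have hY := posSemidef_conj (posSemidef_matPow hσ ((1 - α) / z))
    (isHermitian_matPow ρ (α / z / 2))
  rw [Qaz_eq hρ hσ α hz, reTrace_matPow hY hz]
  obtain ⟨i, _, hi⟩ := Finset.exists_lt_of_sum_lt (s := Finset.univ) (f := fun _ : ι => (0 : ℝ))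
    (g := hρ.1.eigenvalues) (by
      rw [← reTrace_eq_sum]
      simpa using reTrace_pos hρ h0)
  set v := eigVec hρ.1 i
  have hρv : quadForm ρ v = hρ.1.eigenvalues i := by
    conv_lhs => rw [← hermApply_id hρ.1]
    exact quadForm_eigVec hρ.1 _ i
  have hw : (matPow ρ (α / z / 2)).mulVec v =
      ((hρ.1.eigenvalues i ^ (α / z / 2) : ℝ) : ℂ) • v := by
    rw [matPow, hermApply_mulVec _ hρ.1 (mulVec_eigVec hρ.1 i), if_neg hi.ne']
  have hσv : 0 < quadForm σ v := by
    have h1 := quadForm_nonneg h v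
    rw [quadForm_sub, quadForm_smul, hρv] at h1
    exact pos_of_mul_pos_right (b := quadForm σ v) (a := c) (by linarith) hc.le
  have hYv : 0 < quadForm (matPow ρ (α / z / 2) * matPow σ ((1 - α) / z) *
      matPow ρ (α / z / 2)) v := by
    rw [quadForm_conj _ _ (isHermitian_matPow _ _), hw, quadForm_smul_vec]
    have := quadForm_matPow_pos hσ hσv ((1 - α) / z)
    have := Real.rpow_pos_of_pos hi (α / z / 2)
    positivity
  refine lt_of_le_of_ne (Finset.sum_nonneg fun j _ => Real.rpow_nonneg (hY.eigenvalues_nonneg j) z)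
    fun hsum => hYv.ne' ?_
  rw [eq_comm, Finset.sum_eq_zero_iff_of_nonneg
    fun j _ => Real.rpow_nonneg (hY.eigenvalues_nonneg j) z] at hsum
  rw [quadForm_self hY.1]
  refine Finset.sum_eq_zero fun j _ => ?_
  rw [(Real.rpow_eq_zero (hY.eigenvalues_nonneg j) hz.ne').1 (hsum j (Finset.mem_univ j)), zero_mul]

/-- `α > 1` : the upper bound on the trace quantity. -/
theorem Qaz_le {ρ σ : Matrix ι ι ℂ} (hρ : ρ.PosSemidef) (hσ : σ.PosSemidef) {c : ℝ}
    (hc : 0 < c) (h : loewnerLE ρ (c • σ)) {α z : ℝ} (hα : 1 < α) (hz : 0 < z) (hαz : α - 1 ≤ z) :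
    Qaz α z ρ σ ≤ c ^ (α - 1) * reTrace ρ := by
  set s := (α - 1) / z with hs
  have hs0 : 0 < s := div_pos (by linarith) hz
  have hs1 : s ≤ 1 := (div_le_one hz).2 hαz
  have hY := posSemidef_conj (posSemidef_matPow hσ ((1 - α) / z))
    (isHermitian_matPow ρ (α / z / 2))
  have hB := posSemidef_matPow hρ (1 / z)
  have hK : 0 < c ^ s := Real.rpow_pos_of_pos hc s
  have hle : ∀ v, quadForm (matPow ρ (α / z / 2) * matPow σ ((1 - α) / z) *
      matPow ρ (α / z / 2)) v ≤ c ^ s * quadForm (matPow ρ (1 / z)) v := by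
    intro v
    have h1 := quadForm_conj_neg_le hρ hσ hc h hs0 hs1 ((matPow ρ (1 / z / 2)).mulVec v)
    have hR := isHermitian_matPow ρ (1 / z / 2)
    rw [← quadForm_conj _ _ hR, ← quadForm_conj _ _ hR, Matrix.mul_one, matPow_mul hρ,
      add_halves] at h1
    convert h1 using 2
    rw [show α / z / 2 = 1 / z / 2 + s / 2 by rw [hs]; field_simp; ring, ← matPow_mul hρ,
      show (1 - α) / z = -s by rw [hs]; ring]
    simp only [Matrix.mul_assoc]
    rw [matPow_mul hρ, matPow_mul hρ, add_comm (s / 2)]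
  have hcomp := eigenvalues_compare hY.1 hB.1 (fun t => t / c ^ s) (by
    intro j v hv
    rw [div_mul_eq_mul_div, div_le_iff₀ hK, mul_comm _ (c ^ s)]
    refine le_trans ?_ (hle v)
    rw [quadForm_self hY.1, quadForm_one hY.1, Finset.mul_sum]
    refine Finset.sum_le_sum fun i _ => ?_
    by_cases hi : hY.1.eigenvalues i < hY.1.eigenvalues j
    · simp [hv i hi]
    · exact mul_le_mul_of_nonneg_right (not_lt.1 hi) (by positivity))
  have htr : reTrace ρ = ∑ i, hB.1.eigenvalues i ^ z := by
    rw [← reTrace_matPow hB hz, matPow_matPow hρ, one_div_mul_cancel hz.ne', matPow_one hρ]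
  rw [Qaz_eq hρ hσ α hz, reTrace_matPow hY hz, htr, Finset.mul_sum]
  refine Finset.sum_le_sum fun i _ => ?_
  have hi := hcomp i
  simp only [div_le_iff₀ hK] at hi
  calc hY.1.eigenvalues i ^ z ≤ (hB.1.eigenvalues i * c ^ s) ^ z :=
        Real.rpow_le_rpow (hY.eigenvalues_nonneg i) hi hz.le
    _ = c ^ (α - 1) * hB.1.eigenvalues i ^ z := by
        rw [Real.mul_rpow (hB.eigenvalues_nonneg i) hK.le, ← Real.rpow_mul hc.le, hs,
          div_mul_cancel₀ _ hz.ne', mul_comm]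

/-- Weighted lower bound of the quadratic form of a power on a spectral subspace. -/
theorem rpow_mul_quadForm_le {ρ : Matrix ι ι ℂ} (hρ : ρ.PosSemidef) {μ x : ℝ} (hμ : 0 < μ)
    (hx : 0 ≤ x) (y : ℝ) {v : ι → ℂ} (hv : ∀ i, hρ.1.eigenvalues i < μ → eigCoord hρ.1 v i = 0) :
    μ ^ x * quadForm (matPow ρ y) v ≤ quadForm (matPow ρ (x + y)) v := by
  unfold matPow
  rw [quadForm_hermApply _ hρ.1, quadForm_hermApply _ hρ.1, Finset.mul_sum]
  refine Finset.sum_le_sum fun i _ => ?_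
  by_cases hi : hρ.1.eigenvalues i < μ
  · simp [hv i hi]
  · have hi' := not_lt.1 hi
    have hpos := hμ.trans_le hi'
    rw [if_neg hpos.ne', if_neg hpos.ne', Real.rpow_add hpos, ← mul_assoc]
    exact mul_le_mul_of_nonneg_right (mul_le_mul_of_nonneg_right
      (Real.rpow_le_rpow hμ.le hi' hx) (Real.rpow_nonneg hpos.le y)) (by positivity)

theorem one_le_rpow_tangent {s ν t : ℝ} (hs : 1 ≤ s) (hν : 0 < ν) (ht : 0 ≤ t) :
    s * ν ^ s / ν * t - (s - 1) * ν ^ s ≤ t ^ s := by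
  have h := one_add_mul_self_le_rpow_one_add (s := t / ν - 1) (by
    have : 0 ≤ t / ν := by positivity
    linarith) hs
  rw [add_sub_cancel, Real.div_rpow ht hν.le, le_div_iff₀ (Real.rpow_pos_of_pos hν s)] at h
  refine le_trans (le_of_eq ?_) h
  field_simp
  ring

theorem rpow_mul_le_quadForm_matPow {ρ σ : Matrix ι ι ℂ} (hρ : ρ.PosSemidef) (hσ : σ.PosSemidef)
    {c : ℝ} (hc : 0 < c) (h : loewnerLE ρ (c • σ)) {s : ℝ} (hs0 : 0 < s) {μ : ℝ} (hμ : 0 < μ)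
    {w : ι → ℂ} (hw1 : μ * quadForm 1 w ≤ quadForm ρ w)
    (hws : μ ^ s * quadForm 1 w ≤ quadForm (matPow ρ s) w) :
    (μ / c) ^ s * quadForm 1 w ≤ quadForm (matPow σ s) w := by
  have hcs := Real.rpow_pos_of_pos hc s
  rcases le_total s 1 with hs1 | hs1
  · rw [Real.div_rpow hμ.le hc.le, div_mul_eq_mul_div, div_le_iff₀ hcs, mul_comm _ (c ^ s)]
    exact hws.trans (quadForm_matPow_le hρ hσ hc h hs0 hs1 w)
  · set ν := μ / c with hν
    have hν0 : 0 < ν := div_pos hμ hc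
    have hνs := Real.rpow_pos_of_pos hν0 s
    have hσw : ν * quadForm 1 w ≤ quadForm σ w := by
      have h1 := quadForm_nonneg h w
      rw [quadForm_sub, quadForm_smul] at h1
      rw [hν, div_mul_eq_mul_div, div_le_iff₀ hc]
      linarith
    have htan : s * ν ^ s / ν * quadForm σ w - (s - 1) * ν ^ s * quadForm 1 w ≤
        quadForm (matPow σ s) w := by
      unfold matPow
      rw [quadForm_hermApply _ hσ.1, quadForm_self hσ.1, quadForm_one hσ.1, Finset.mul_sum,
        Finset.mul_sum, ← Finset.sum_sub_distrib]
      refine Finset.sum_le_sum fun i _ => ?_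
      rw [← mul_assoc, ← sub_mul]
      refine mul_le_mul_of_nonneg_right ?_ (by positivity)
      refine (one_le_rpow_tangent hs1 hν0 (hσ.eigenvalues_nonneg i)).trans (le_of_eq ?_)
      split_ifs with h0
      · rw [h0, Real.zero_rpow hs0.ne']
      · rfl
    refine le_trans ?_ htan
    have h2 := mul_le_mul_of_nonneg_left hσw (a := s * ν ^ s / ν) (by positivity)
    have h3 : s * ν ^ s / ν * (ν * quadForm 1 w) = s * ν ^ s * quadForm 1 w := by
      field_simp
    linarith

/-- `α < 1` : the lower bound on the trace quantity. -/
theorem le_Qaz {ρ σ : Matrix ι ι ℂ} (hρ : ρ.PosSemidef) (hσ : σ.PosSemidef) {c : ℝ}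
    (hc : 0 < c) (h : loewnerLE ρ (c • σ)) {α z : ℝ} (hα0 : 0 < α) (hα : α < 1) (hz : 0 < z) :
    c ^ (α - 1) * reTrace ρ ≤ Qaz α z ρ σ := by
  set s := (1 - α) / z with hs
  have hs0 : 0 < s := div_pos (by linarith) hz
  set a := α / z with ha
  have ha0 : 0 < a := div_pos hα0 hz
  have hR : (matPow ρ (a / 2)).IsHermitian := isHermitian_matPow _ _
  have hY := posSemidef_conj (posSemidef_matPow hσ s) hR
  have hcomp := eigenvalues_compare hρ.1 hY.1 (fun t => (t / c) ^ s * t ^ a) (by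
    intro j v hv
    rcases (hρ.eigenvalues_nonneg j).eq_or_lt with h0 | hμ
    · rw [← h0]
      simpa [Real.zero_rpow hs0.ne'] using quadForm_nonneg hY v
    · set μ := hρ.1.eigenvalues j
      have hv1 : μ ^ a * quadForm 1 v ≤ quadForm (matPow ρ a) v := by
        unfold matPow
        rw [quadForm_one hρ.1, quadForm_hermApply _ hρ.1, Finset.mul_sum]
        refine Finset.sum_le_sum fun i _ => ?_
        by_cases hi : hρ.1.eigenvalues i < μ
        · simp [hv i hi]
        · have hi' := not_lt.1 hi
          rw [if_neg (hμ.trans_le hi').ne']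
          exact mul_le_mul_of_nonneg_right (Real.rpow_le_rpow hμ.le hi' ha0.le) (by positivity)
      have e1 : quadForm 1 ((matPow ρ (a / 2)).mulVec v) = quadForm (matPow ρ a) v := by
        rw [← quadForm_conj _ _ hR, Matrix.mul_one, matPow_mul hρ, add_halves]
      have e2 : ∀ x, quadForm (matPow ρ x) ((matPow ρ (a / 2)).mulVec v) =
          quadForm (matPow ρ (x + a)) v := by
        intro x
        rw [← quadForm_conj _ _ hR, matPow_mul hρ, matPow_mul hρ]
        congr 2
        ring
      have hw1 : μ * quadForm 1 ((matPow ρ (a / 2)).mulVec v) ≤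
          quadForm ρ ((matPow ρ (a / 2)).mulVec v) := by
        have := rpow_mul_quadForm_le hρ hμ zero_le_one a hv
        rwa [← e2, matPow_one hρ, Real.rpow_one, ← e1] at this
      have hws := rpow_mul_quadForm_le hρ hμ hs0.le a hv
      rw [← e2, ← e1] at hws
      have hfin := rpow_mul_le_quadForm_matPow hρ hσ hc h hs0 hμ hw1 hws
      rw [quadForm_conj _ _ hR, mul_assoc]
      refine le_trans (mul_le_mul_of_nonneg_left ?_
        (Real.rpow_nonneg (div_nonneg hμ.le hc.le) s)) hfin
      rw [e1]
      exact hv1)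
  rw [Qaz_eq hρ hσ α hz, reTrace_matPow hY hz, reTrace_eq_sum hρ.1, Finset.mul_sum]
  refine Finset.sum_le_sum fun i _ => ?_
  have hp := hρ.eigenvalues_nonneg i
  have hi := Real.rpow_le_rpow (by positivity) (hcomp i) hz.le
  refine le_trans (le_of_eq ?_) hi
  rcases hp.eq_or_lt with h0 | h0
  · rw [← h0]
    simp [Real.zero_rpow hs0.ne', Real.zero_rpow hz.ne']
  · rw [Real.mul_rpow (by positivity) (by positivity), ← Real.rpow_mul (by positivity),
      ← Real.rpow_mul h0.le, hs, ha, div_mul_cancel₀ _ hz.ne', div_mul_cancel₀ _ hz.ne',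
      Real.div_rpow h0.le hc.le, div_mul_eq_mul_div, ← Real.rpow_add h0,
      sub_add_cancel, Real.rpow_one, show α - 1 = -(1 - α) by ring, Real.rpow_neg hc.le]
    field_simp

theorem eigCoord_eq_zero {ρ σ : Matrix ι ι ℂ} (hρ : ρ.IsHermitian) (hσ : σ.IsHermitian)
    (h : suppLE ρ σ) {i j : ι} (hi : hρ.eigenvalues i ≠ 0) (hj : hσ.eigenvalues j = 0) :
    eigCoord hσ (eigVec hρ i) j = 0 := by
  have h1 : ρ.mulVec (eigVec hσ j) = 0 := h _ (by rw [mulVec_eigVec, hj]; simp)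
  have h2 : eigCoord hσ (eigVec hρ i) j = star (eigVec hσ j) ⬝ᵥ eigVec hρ i := by
    simp [eigCoord, eigVec, Matrix.mulVec, dotProduct, Matrix.star_apply, Matrix.col]
  have h3 : star (eigVec hσ j) ⬝ᵥ ρ.mulVec (eigVec hρ i) = 0 := by
    have h4 := Matrix.star_mulVec ρ (eigVec hσ j)
    rw [h1, hρ.eq] at h4
    rw [Matrix.dotProduct_mulVec, ← h4]
    simp
  rw [mulVec_eigVec, dotProduct_smul, ← h2] at h3
  simpa [hi] using h3

/-- `α = 1` : the upper bound on the relative entropy. -/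
theorem reTrace_mul_matLog_sub_le {ρ σ : Matrix ι ι ℂ} (hρ : ρ.PosSemidef) (hσ : σ.PosSemidef)
    {c : ℝ} (hc : 0 < c) (h : loewnerLE ρ (c • σ)) :
    reTrace (ρ * (matLog ρ - matLog σ)) ≤ Real.log c * reTrace ρ := by
  have hsupp := suppLE_of_loewnerLE hρ h
  have e := reTrace_mul_hermApply (fun t => t) hρ.1 (matLog ρ - matLog σ)
  rw [hermApply_id hρ.1] at e
  rw [e, reTrace_eq_sum hρ.1, Finset.mul_sum]
  refine Finset.sum_le_sum fun i _ => ?_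
  rw [mul_comm]
  refine (hρ.eigenvalues_nonneg i).eq_or_lt.elim (fun h0 => by rw [← h0]; simp) fun hp => ?_
  refine mul_le_mul_of_nonneg_right ?_ hp.le
  set p := hρ.1.eigenvalues i
  set v := eigVec hρ.1 i
  have hv1 : quadForm 1 v = 1 := by
    have := quadForm_eigVec hρ.1 (fun _ => 1) i
    have h1 : cfc (fun _ : ℝ => (1 : ℝ)) ρ = 1 := cfc_const_one ℝ ρ hρ.1
    rwa [hermApply_eq_cfc, h1] at this
  have hlog : quadForm (matLog ρ) v = Real.log p := quadForm_eigVec hρ.1 _ i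
  have hinv : p * quadForm (matPow σ (-1)) v ≤ c := by
    have h1 := quadForm_conj_neg_le hρ hσ hc h one_pos le_rfl v
    have hw : (matPow ρ (1 / 2)).mulVec v = ((p ^ (1 / 2 : ℝ) : ℝ) : ℂ) • v := by
      rw [matPow, hermApply_mulVec _ hρ.1 (mulVec_eigVec hρ.1 i), if_neg hp.ne']
    rw [quadForm_conj _ _ (isHermitian_matPow _ _), hw, quadForm_smul_vec, hv1, Real.rpow_one,
      mul_one, ← Real.rpow_natCast, ← Real.rpow_mul hp.le] at h1
    norm_num at h1
    exact h1
  have hsum : Real.log p * quadForm 1 v - quadForm (matLog σ) v ≤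
      (Real.log c - 1) * quadForm 1 v + p / c * quadForm (matPow σ (-1)) v := by
    unfold matLog matPow
    rw [quadForm_hermApply _ hσ.1, quadForm_hermApply _ hσ.1, quadForm_one hσ.1, Finset.mul_sum,
      Finset.mul_sum, Finset.mul_sum, ← Finset.sum_sub_distrib, ← Finset.sum_add_distrib]
    refine Finset.sum_le_sum fun j _ => ?_
    rcases (hσ.eigenvalues_nonneg j).eq_or_lt with h0 | hq
    · simp [eigCoord_eq_zero hρ.1 hσ.1 hsupp hp.ne' h0.symm, v]
    · rw [← mul_assoc, ← sub_mul, ← add_mul]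
      refine mul_le_mul_of_nonneg_right ?_ (by positivity)
      rw [if_neg hq.ne', Real.rpow_neg_one]
      set q := hσ.1.eigenvalues j
      have := Real.log_le_sub_one_of_pos (x := p / c * q⁻¹) (by positivity)
      rw [Real.log_mul (by positivity) (by positivity), Real.log_div hp.ne' hc.ne',
        Real.log_inv] at this
      linarith
  rw [hv1, div_mul_eq_mul_div] at hsum
  rw [quadForm_sub, hlog]
  have := (div_le_one hc).2 hinv
  linarith

theorem Dfull_le_log {ρ σ : Matrix ι ι ℂ} (hρ : ρ.PosSemidef) (h0 : ρ ≠ 0) (hσ : σ.PosSemidef)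
    {c : ℝ} (hc : 0 < c) (h : loewnerLE ρ (c • σ)) {α z : ℝ} (hα : 0 < α) (hz : 0 < z)
    (hαz : α ≤ 1 ∨ (1 < α ∧ α - 1 ≤ z)) :
    ∃ d : ℝ, Dfull α z ρ σ = (d : EReal) ∧ d ≤ Real.log c := by
  have hsupp := suppLE_of_loewnerLE hρ h
  have hT := reTrace_pos hρ h0
  have hQ := Qaz_pos hρ h0 hσ hc h α hz
  unfold Dfull DUm Daz
  split_ifs with h1 h2
  · refine ⟨_, rfl, ?_⟩
    rw [inv_mul_le_iff₀ hT, mul_comm]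
    exact reTrace_mul_matLog_sub_le hρ hσ hc h
  · refine ⟨_, rfl, ?_⟩
    have hcpos := Real.rpow_pos_of_pos hc (α - 1)
    rcases lt_or_gt_of_ne h1 with hlt | hgt
    · have := Real.log_le_log (by positivity) (le_Qaz hρ hσ hc h hα hlt hz)
      rw [Real.log_mul hcpos.ne' hT.ne', Real.log_rpow hc] at this
      rw [inv_mul_eq_div, div_le_iff_of_neg (by linarith)]
      linarith
    · have := Real.log_le_log hQ (Qaz_le hρ hσ hc h hgt hz (by
        rcases hαz with h' | h'
        · linarith
        · exact h'.2))
      rw [Real.log_mul hcpos.ne' hT.ne', Real.log_rpow hc] at this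
      rw [inv_mul_eq_div, div_le_iff₀ (by linarith)]
      linarith
  · exact absurd ⟨Or.inl hsupp, hQ.ne'⟩ h2

theorem Dfull_le_Dmax {ρ σ : Matrix ι ι ℂ} (hρ : ρ.PosSemidef) (h0 : ρ ≠ 0) (hσ : σ.PosSemidef)
    {α z : ℝ} (hα : 0 < α) (hz : 0 < z) (hαz : α ≤ 1 ∨ (1 < α ∧ α - 1 ≤ z)) :
    Dfull α z ρ σ ≤ Dmax ρ σ := by
  unfold Dmax
  split_ifs with hex
  · obtain ⟨c, hc, h⟩ := hex
    obtain ⟨d, hd, -⟩ := Dfull_le_log hρ h0 hσ hc h hα hz hαz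
    rw [hd, EReal.coe_le_coe_iff]
    have hinf : Real.exp d ≤ sInf {c : ℝ | 0 < c ∧ loewnerLE ρ (c • σ)} := by
      refine le_csInf ⟨c, hc, h⟩ fun b hb => ?_
      obtain ⟨d', hd', hle⟩ := Dfull_le_log hρ h0 hσ hb.1 hb.2 hα hz hαz
      rw [hd, EReal.coe_eq_coe_iff] at hd'
      rw [hd']
      exact (Real.le_log_iff_exp_le hb.1).1 hle
    exact (Real.le_log_iff_exp_le ((Real.exp_pos d).trans_le hinf)).2 hinf
  · exact le_top

theorem matPow_of_isIdempotentElem {P : Matrix ι ι ℂ} (hP : P.PosSemidef) (h : P * P = P)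
    (x : ℝ) :
    matPow P x = P := by
  conv_rhs => rw [← hermApply_id hP.1]
  unfold matPow hermApply
  rw [dif_pos hP.1, dif_pos hP.1]
  unfold Matrix.IsHermitian.cfc
  congr 3
  ext i
  have h2 : hP.1.eigenvalues i * hP.1.eigenvalues i = hP.1.eigenvalues i := by
    have h1 := hermApply_mul (fun t => t) (fun t => t) P
    rw [hermApply_id hP.1, h] at h1
    have e1 := quadForm_eigVec hP.1 (fun t => t * t) i
    rw [← h1] at e1
    have e2 := quadForm_eigVec hP.1 (fun t => t) i
    rw [hermApply_id hP.1] at e2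
    exact e1.symm.trans e2
  by_cases h0 : hP.1.eigenvalues i = 0
  · simp [h0]
  · have : hP.1.eigenvalues i = 1 := mul_left_cancel₀ h0 (by rw [h2, mul_one])
    simp [this]

theorem matPow_diagonal {d : ι → ℝ} (hd : (Matrix.diagonal fun i => (d i : ℂ)).IsHermitian)
    (x : ℝ) :
    matPow (Matrix.diagonal fun i => (d i : ℂ)) x =
      Matrix.diagonal fun i => ((if d i = 0 then 0 else d i ^ x : ℝ) : ℂ) := by
  refine Matrix.ext_of_mulVec_single fun j => ?_
  rw [matPow, hermApply_mulVec _ hd (t := d j)]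
  · ext i
    rcases eq_or_ne i j with rfl | hij <;> simp [Matrix.mulVec_diagonal, *]
  · ext i
    rcases eq_or_ne i j with rfl | hij <;> simp [Matrix.mulVec_diagonal, *]

omit [Fintype ι] [DecidableEq ι] in
theorem Dmax_le_log {ρ σ : Matrix ι ι ℂ} {c : ℝ} (hc : 1 ≤ c) (h : loewnerLE ρ (c • σ)) :
    Dmax ρ σ ≤ (Real.log c : EReal) := by
  have hmem : c ∈ {c : ℝ | 0 < c ∧ loewnerLE ρ (c • σ)} := ⟨by linarith, h⟩
  unfold Dmax
  rw [if_pos ⟨c, hmem⟩, EReal.coe_le_coe_iff]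
  have h0 : 0 ≤ sInf {c : ℝ | 0 < c ∧ loewnerLE ρ (c • σ)} :=
    Real.sInf_nonneg fun b hb => hb.1.le
  rcases h0.eq_or_lt with h1 | h1
  · rw [← h1, Real.log_zero]
    exact Real.log_nonneg hc
  · exact Real.log_le_log h1 (csInf_le ⟨0, fun b hb => hb.1.le⟩ hmem)

/-- The (unnormalized) vector of the pure state violating the bound. -/
def cexVec (m : ℕ) : Fin (m + 2) → ℂ := fun i => if i = 0 then 1 else if i = 1 then 1 else 0

/-- The pure state violating the bound. -/
def cexState (m : ℕ) : Matrix (Fin (m + 2)) (Fin (m + 2)) ℂ :=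
  (1 / 2 : ℝ) • Matrix.vecMulVec (cexVec m) (star (cexVec m))

/-- The spectrum of the diagonal state violating the bound. -/
def cexDiag (m : ℕ) : Fin (m + 2) → ℝ :=
  fun i => if i = 0 then 1 / 3 else if i = 1 then 2 / 3 else 0

/-- The diagonal state violating the bound. -/
def cexRef (m : ℕ) : Matrix (Fin (m + 2)) (Fin (m + 2)) ℂ :=
  Matrix.diagonal fun i => (cexDiag m i : ℂ)

theorem posSemidef_cexState (m : ℕ) : (cexState m).PosSemidef :=
  (Matrix.posSemidef_vecMulVec_self_star _).smul (by norm_num)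

theorem posSemidef_cexRef (m : ℕ) : (cexRef m).PosSemidef := by
  refine Matrix.PosSemidef.diagonal fun i => ?_
  simp only [cexDiag]
  split_ifs <;> norm_num [Complex.nonneg_iff]

theorem trace_cexState (m : ℕ) : (cexState m).trace = 1 := by
  simp [cexState, cexVec, Matrix.trace, Matrix.vecMulVec_apply, Fin.sum_univ_succ, Fin.succ_ne_zero,
    ← Fin.succ_zero_eq_one, Fin.succ_inj, -Fin.succ_zero_eq_one']
  norm_num

theorem trace_cexRef (m : ℕ) : (cexRef m).trace = 1 := by
  simp [cexRef, cexDiag, Matrix.trace, Fin.sum_univ_succ, Fin.succ_ne_zero,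
    ← Fin.succ_zero_eq_one, Fin.succ_inj, -Fin.succ_zero_eq_one']
  norm_num

theorem loewnerLE_cex (m : ℕ) : loewnerLE (cexState m) ((9 / 4 : ℝ) • cexRef m) := by
  have h := Matrix.posSemidef_vecMulVec_self_star
    (fun i : Fin (m + 2) => if i = 0 then (1 / 2 : ℂ) else if i = 1 then -1 else 0)
  unfold loewnerLE
  convert h using 1
  ext i j
  simp only [cexState, cexRef, cexVec, cexDiag, Matrix.sub_apply, Matrix.smul_apply,
    Matrix.vecMulVec_apply, Matrix.diagonal_apply, Pi.star_apply, Complex.real_smul]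
  have h01 : (0 : Fin (m + 2)) ≠ 1 := by simp
  by_cases hij : i = j
  · subst hij
    rw [if_pos rfl]
    split_ifs <;> norm_num
  · rw [if_neg hij]
    split_ifs <;> first
      | (subst_vars; exact absurd rfl hij)
      | norm_num

theorem cexState_conj (m : ℕ) (w : Fin (m + 2) → ℝ) :
    cexState m * (Matrix.diagonal fun i => (w i : ℂ)) * cexState m =
      ((w 0 + w 1) / 2) • cexState m := by
  have h : Matrix.vecMul (star (cexVec m)) (Matrix.diagonal fun i => (w i : ℂ)) ⬝ᵥ cexVec m =
      ((w 0 + w 1 : ℝ) : ℂ) := by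
    simp [cexVec, dotProduct, Matrix.vecMul_diagonal, Fin.sum_univ_succ, Fin.succ_ne_zero,
      ← Fin.succ_zero_eq_one, Fin.succ_inj, -Fin.succ_zero_eq_one']
  unfold cexState
  rw [Matrix.smul_mul, Matrix.smul_mul, Matrix.mul_smul, Matrix.vecMulVec_mul,
    Matrix.vecMulVec_mul_vecMulVec, h]
  ext i j
  simp [Matrix.vecMulVec_apply]
  ring

theorem cexState_mul_self (m : ℕ) : cexState m * cexState m = cexState m := by
  have h := cexState_conj m fun _ => 1
  have h1 : (Matrix.diagonal fun _ : Fin (m + 2) => ((1 : ℝ) : ℂ)) = 1 := by simp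
  rw [h1] at h
  simpa using h

theorem Qaz_cex (m : ℕ) (α : ℝ) {z : ℝ} (hz : 0 < z) :
    Qaz α z (cexState m) (cexRef m) =
      (((1 / 3) ^ ((1 - α) / z) + (2 / 3) ^ ((1 - α) / z)) / 2 : ℝ) ^ z := by
  rw [Qaz_eq (posSemidef_cexState m) (posSemidef_cexRef m) α hz,
    matPow_of_isIdempotentElem (posSemidef_cexState m) (cexState_mul_self m), cexRef,
    matPow_diagonal (posSemidef_cexRef m).1, cexState_conj, matPow_smul (posSemidef_cexState m),
    matPow_of_isIdempotentElem (posSemidef_cexState m) (cexState_mul_self m)]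
  · have h10 : (1 : Fin (m + 2)) ≠ 0 := by simp
    simp [reTrace, trace_cexState, cexDiag, h10]
  · have h10 : (1 : Fin (m + 2)) ≠ 0 := by simp
    simp only [cexDiag, h10]
    norm_num
    positivity

theorem rpow_midpoint_lt {s : ℝ} (hs : 1 < s) :
    (9 / 4 : ℝ) ^ s < ((1 / 3) ^ (-s) + (2 / 3) ^ (-s)) / 2 := by
  have h := (strictConvexOn_rpow hs).2 (show (3 : ℝ) ∈ Set.Ici (0 : ℝ) by norm_num)
    (show (3 / 2 : ℝ) ∈ Set.Ici (0 : ℝ) by norm_num) (by norm_num)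
    (show (0 : ℝ) < 1 / 2 by norm_num) (show (0 : ℝ) < 1 / 2 by norm_num) (by norm_num)
  rw [Real.rpow_neg (by norm_num), Real.rpow_neg (by norm_num), ← Real.inv_rpow (by norm_num),
    ← Real.inv_rpow (by norm_num)]
  norm_num at h ⊢
  linarith

theorem Dmax_lt_Dfull_cex (m : ℕ) {α z : ℝ} (hα : 1 < α) (hz : 0 < z) (hαz : z < α - 1) :
    Dmax (cexState m) (cexRef m) < Dfull α z (cexState m) (cexRef m) := by
  refine (Dmax_le_log (by norm_num) (loewnerLE_cex m)).trans_lt ?_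
  unfold Dfull Daz
  rw [if_neg hα.ne']
  split_ifs
  · rw [EReal.coe_lt_coe_iff, Qaz_cex m α hz, show (1 - α) / z = -((α - 1) / z) by ring]
    have hlt := rpow_midpoint_lt (s := (α - 1) / z) ((one_lt_div hz).2 hαz)
    have h94 : (0 : ℝ) < (9 / 4) ^ ((α - 1) / z) := by positivity
    have hlog := Real.log_lt_log h94 hlt
    rw [Real.log_rpow (by norm_num), div_mul_eq_mul_div, div_lt_iff₀ hz] at hlog
    rw [Real.log_rpow (h94.trans hlt), reTrace, trace_cexState, Complex.one_re, Real.log_one,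
      sub_zero, inv_mul_eq_div, lt_div_iff₀ (by linarith)]
    linarith
  · exact EReal.coe_lt_top _

/-- For `α, z ∈ (0,∞)`, the bound `D_{α,z} ≤ D_max` holds on all
pairs of nonzero PSD operators iff it holds for all density operators on some space of
dimension `≥ 2`, iff `α ≤ 1` or (`α > 1` and `z ≥ α - 1`). -/
theorem renyi_az_le_Dmax_tfae (α z : ℝ) (hα : 0 < α) (hz : 0 < z) :
    List.TFAE [
      ∀ (n : ℕ) (ρ σ : Matrix (Fin n) (Fin n) ℂ), ρ.PosSemidef → ρ ≠ 0 →
        σ.PosSemidef → σ ≠ 0 → Dfull α z ρ σ ≤ Dmax ρ σ,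
      ∃ n : ℕ, 2 ≤ n ∧ ∀ ρ σ : Matrix (Fin n) (Fin n) ℂ, ρ.PosSemidef → ρ.trace = 1 →
        σ.PosSemidef → σ.trace = 1 → Dfull α z ρ σ ≤ Dmax ρ σ,
      α ≤ 1 ∨ (1 < α ∧ α - 1 ≤ z) ] := by
  tfae_have 3 → 1 := fun h n ρ σ hρ h0 hσ _ => Dfull_le_Dmax hρ h0 hσ hα hz h
  tfae_have 1 → 2 := fun h => ⟨2, le_rfl, fun ρ σ hρ hρ1 hσ hσ1 =>
    h 2 ρ σ hρ (fun h0 => by simp [h0] at hρ1) hσ (fun h0 => by simp [h0] at hσ1)⟩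
  tfae_have 2 → 3 := by
    rintro ⟨n, hn, h⟩
    obtain ⟨m, rfl⟩ := Nat.exists_eq_add_of_le' hn
    by_contra! hcon
    exact absurd (h _ _ (posSemidef_cexState m) (trace_cexState m) (posSemidef_cexRef m)
      (trace_cexRef m)) (not_le.2 (Dmax_lt_Dfull_cex m hcon.1 hz (hcon.2 hcon.1)))
  tfae_finish

end QRenyi

end
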